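/- (CFL′ implies the natural CFL condition) Assume (A1) and that m⁰ is finite. If (U^{α,n}_i) solves the scheme (NS) and the CFL condition (CFL′) holds, then for every n_T ∈ ℕ the natural CFL condition holds: Δx/Δt ≥ sup{|H′_α(p^{α,n}_{i,+})| : α = 1,…,N, i ≥ 0, 0 ≤ n ≤ n_T}. -/

import Mathlib

open Set Filter

/-- Assumption (A1) for a single Hamiltonian: `H` is `C¹`, coercive
(`H p → +∞` as `|p| → +∞`), non-increasing on `(-∞, p₀]` and non-decreasing on `[p₀, +∞)`. -/
def A1cond (H : ℝ → ℝ) (p₀ : ℝ) : Prop :=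
  ContDiff ℝ 1 H ∧ Tendsto H (cocompact ℝ) atTop ∧
    AntitoneOn H (Iic p₀) ∧ MonotoneOn H (Ici p₀)

/-- The non-increasing envelope `H⁻` of `H` with turning point `p₀`. -/
noncomputable def Hm (H : ℝ → ℝ) (p₀ : ℝ) (p : ℝ) : ℝ :=
  if p ≤ p₀ then H p else H p₀

/-- The non-decreasing envelope `H⁺` of `H` with turning point `p₀`. -/
noncomputable def Hp (H : ℝ → ℝ) (p₀ : ℝ) (p : ℝ) : ℝ :=
  if p ≤ p₀ then H p₀ else H p

/-- One time step of the numerical scheme (NS) on the junction: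
`V` (the values at time `n+1`) is computed from `U` (the values at time `n`).
For `i ≥ 1` on each branch `α` the update uses
`max (H⁺_α(p_{i,-}), H⁻_α(p_{i,+}))`; at the junction point `i = 0` all branches share a
common value and the update uses `max_β H⁻_β(p^β_{0,+})`. -/
def SchemeStep {N : ℕ} (H : Fin N → ℝ → ℝ) (p₀ : Fin N → ℝ) (Δx Δt : ℝ)
    (U V : Fin N → ℕ → ℝ) : Prop :=
  (∀ (α : Fin N) (i : ℕ), 1 ≤ i →
      V α i = U α i - Δt * max (Hp (H α) (p₀ α) ((U α i - U α (i - 1)) / Δx))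
        (Hm (H α) (p₀ α) ((U α (i + 1) - U α i) / Δx))) ∧
  (∀ α β : Fin N, U α 0 = U β 0) ∧
  (∀ α : Fin N, V α 0 = U α 0 - Δt *
      sSup (Set.range fun β : Fin N => Hm (H β) (p₀ β) ((U β 1 - U β 0) / Δx)))

/-- The numerical scheme (NS): `U α n i` is the value on branch `α` at time step `n`
and grid point `i`. -/
def SchemeNS {N : ℕ} (H : Fin N → ℝ → ℝ) (p₀ : Fin N → ℝ) (Δx Δt : ℝ)
    (U : Fin N → ℕ → ℕ → ℝ) : Prop :=
  ∀ n : ℕ, SchemeStep H p₀ Δx Δt (fun α i => U α n i) (fun α i => U α (n + 1) i)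

theorem Hp_eq_max (H : ℝ → ℝ) (p₀ p : ℝ) : Hp H p₀ p = H (max p p₀) := by
  unfold Hp
  split_ifs with h
  · rw [max_eq_right h]
  · rw [max_eq_left (not_le.1 h).le]

theorem Hm_eq_Hp_reflect (H : ℝ → ℝ) (p₀ p : ℝ) :
    Hm H p₀ p = Hp (fun x => H (-x)) (-p₀) (-p) := by
  rw [Hp_eq_max, max_neg_neg, neg_neg]
  unfold Hm
  split_ifs with h
  · rw [min_eq_left h]
  · rw [min_eq_right (not_le.1 h).le]

theorem A1cond.reflect {H : ℝ → ℝ} {p₀ : ℝ} (h : A1cond H p₀) :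
    A1cond (fun x => H (-x)) (-p₀) := by
  obtain ⟨h1, h2, h3, h4⟩ := h
  refine ⟨h1.comp contDiff_neg, h2.comp (Homeomorph.neg ℝ).isClosedEmbedding.tendsto_cocompact,
    fun x hx y hy hxy => h4 ?_ ?_ (neg_le_neg hxy), fun x hx y hy hxy => h3 ?_ ?_ (neg_le_neg hxy)⟩
  all_goals simp only [mem_Iic, mem_Ici] at *; linarith

theorem A1cond.Hp_mono {H : ℝ → ℝ} {p₀ : ℝ} (h : A1cond H p₀) : Monotone (Hp H p₀) := by
  intro x y hxy
  rw [Hp_eq_max, Hp_eq_max]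
  exact h.2.2.2 (mem_Ici.2 (le_max_right _ _)) (mem_Ici.2 (le_max_right _ _))
    (max_le_max_right _ hxy)

theorem A1cond.le_Hp {H : ℝ → ℝ} {p₀ : ℝ} (h : A1cond H p₀) (p : ℝ) : H p₀ ≤ Hp H p₀ p := by
  rw [Hp_eq_max]
  exact h.2.2.2 self_mem_Ici (mem_Ici.2 (le_max_right _ _)) (le_max_right _ _)

/-- The supremum of the level set `{H⁺ = c}` bounds the sublevel set `{H⁺ ≤ c}` exactly. -/
theorem A1cond.sSup_level {H : ℝ → ℝ} {p₀ c : ℝ} (h : A1cond H p₀) (hc : H p₀ ≤ c) :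
    p₀ ≤ sSup {p | Hp H p₀ p = c} ∧ Hp H p₀ (sSup {p | Hp H p₀ p = c}) = c ∧
      ∀ p, Hp H p₀ p ≤ c ↔ p ≤ sSup {p | Hp H p₀ p = c} := by
  set S : Set ℝ := {p | Hp H p₀ p = c} with hS
  have hcont : Continuous H := h.1.continuous
  have hev : ∀ᶠ p in atTop, c < H p := (h.2.1.mono_left atTop_le_cocompact).eventually_gt_atTop c
  obtain ⟨a, ha⟩ := eventually_atTop.1 hev
  obtain ⟨q, hq, hqc⟩ : c ∈ H '' Icc p₀ (max a p₀) :=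
    intermediate_value_Icc (le_max_right _ _) hcont.continuousOn
      ⟨hc, (ha _ (le_max_left _ _)).le⟩
  have hqS : q ∈ S := by
    change Hp H p₀ q = c
    rw [Hp_eq_max, max_eq_left hq.1, hqc]
  have hbdd : BddAbove S := by
    refine ⟨a, fun p hp => ?_⟩
    by_contra! hap
    have hp' : Hp H p₀ p = c := hp
    rw [Hp_eq_max] at hp'
    exact (ha _ (hap.le.trans (le_max_left _ _))).ne' hp'
  have hclosed : IsClosed S := by
    have hfun : Hp H p₀ = fun p => H (max p p₀) := funext (Hp_eq_max H p₀)
    rw [hS, hfun]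
    exact isClosed_eq (by fun_prop) continuous_const
  have hmem : Hp H p₀ (sSup S) = c := hclosed.csSup_mem ⟨q, hqS⟩ hbdd
  refine ⟨hq.1.trans (le_csSup hbdd hqS), hmem, fun p => ⟨fun hp => ?_, fun hp => ?_⟩⟩
  · by_contra! hlt
    exact hlt.not_ge (le_csSup hbdd (le_antisymm hp (hmem ▸ h.Hp_mono hlt.le)))
  · exact hmem ▸ h.Hp_mono hp

theorem A1cond.sub_Hp_le {H : ℝ → ℝ} {p₀ K b p : ℝ} (h : A1cond H p₀) (hb : p₀ ≤ b)
    (hK : ∀ x ∈ Icc p₀ b, |deriv H x| ≤ K) (hp : p ≤ b) :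
    Hp H p₀ b - Hp H p₀ p ≤ K * (b - p) := by
  have hK0 : 0 ≤ K := (abs_nonneg _).trans (hK b ⟨hb, le_rfl⟩)
  have hd : Differentiable ℝ H := h.1.differentiable (by norm_num)
  rw [Hp_eq_max, Hp_eq_max, max_eq_left hb]
  have hmv := (convex_Icc p₀ b).image_sub_le_mul_sub_of_deriv_le hd.continuous.continuousOn
    hd.differentiableOn (fun x hx => (le_abs_self _).trans (hK x (interior_subset hx)))
    (max p p₀) ⟨le_max_right _ _, max_le hp hb⟩ b ⟨hb, le_rfl⟩ (max_le hp hb)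
  exact hmv.trans (mul_le_mul_of_nonneg_left (by linarith [le_max_left p p₀]) hK0)

theorem A1cond.sInf_level {H : ℝ → ℝ} {p₀ c : ℝ} (h : A1cond H p₀) (hc : H p₀ ≤ c) :
    sInf {p | Hm H p₀ p = c} ≤ p₀ ∧ Hm H p₀ (sInf {p | Hm H p₀ p = c}) = c ∧
      ∀ p, Hm H p₀ p ≤ c ↔ sInf {p | Hm H p₀ p = c} ≤ p := by
  have hset : sInf {p | Hm H p₀ p = c} = -sSup {p | Hp (fun x => H (-x)) (-p₀) p = c} := by
    rw [← Real.sInf_neg]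
    congr 1
    ext p
    simp [Hm_eq_Hp_reflect]
  obtain ⟨h1, h2, h3⟩ := h.reflect.sSup_level (c := c) (by simpa using hc)
  rw [hset]
  refine ⟨by linarith, by rw [Hm_eq_Hp_reflect, neg_neg, h2], fun p => ?_⟩
  rw [Hm_eq_Hp_reflect, h3, neg_le]

theorem A1cond.sub_Hm_le {H : ℝ → ℝ} {p₀ K a p : ℝ} (h : A1cond H p₀) (ha : a ≤ p₀)
    (hK : ∀ x ∈ Icc a p₀, |deriv H x| ≤ K) (hp : a ≤ p) :
    Hm H p₀ a - Hm H p₀ p ≤ K * (p - a) := by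
  rw [Hm_eq_Hp_reflect, Hm_eq_Hp_reflect]
  have := h.reflect.sub_Hp_le (K := K) (neg_le_neg ha) (fun x hx => ?_) (neg_le_neg hp)
  · linarith
  · rw [deriv_comp_neg, abs_neg]
    exact hK _ ⟨by linarith [hx.2], by linarith [hx.1]⟩

/-- Each grid edge constrains the time increments at its two endpoints. -/
theorem SchemeStep.increment_le {N : ℕ} {H : Fin N → ℝ → ℝ} {p₀ : Fin N → ℝ} {Δx Δt : ℝ}
    (hΔt : 0 < Δt) {U V : Fin N → ℕ → ℝ} (hS : SchemeStep H p₀ Δx Δt U V) (α : Fin N) (i : ℕ) :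
    V α i - U α i ≤ -Δt * Hm (H α) (p₀ α) ((U α (i + 1) - U α i) / Δx) ∧
      V α (i + 1) - U α (i + 1) ≤ -Δt * Hp (H α) (p₀ α) ((U α (i + 1) - U α i) / Δx) := by
  obtain ⟨h1, -, h3⟩ := hS
  constructor
  · rcases Nat.eq_zero_or_pos i with rfl | hi
    · have := mul_le_mul_of_nonneg_left (le_csSup (Set.finite_range fun β : Fin N =>
        Hm (H β) (p₀ β) ((U β 1 - U β 0) / Δx)).bddAbove ⟨α, rfl⟩) hΔt.le
      rw [h3 α, zero_add]
      linarith
    · have := mul_le_mul_of_nonneg_left (le_max_right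
        (Hp (H α) (p₀ α) ((U α i - U α (i - 1)) / Δx))
        (Hm (H α) (p₀ α) ((U α (i + 1) - U α i) / Δx))) hΔt.le
      rw [h1 α i hi]
      linarith
  · have := mul_le_mul_of_nonneg_left (le_max_left
      (Hp (H α) (p₀ α) ((U α (i + 1) - U α i) / Δx))
      (Hm (H α) (p₀ α) ((U α (i + 1 + 1) - U α (i + 1)) / Δx))) hΔt.le
    rw [h1 α (i + 1) (Nat.succ_pos i), Nat.add_sub_cancel]
    linarith

/-- Bounds on the envelopes at all discrete gradients bound the time increments from below. -/
theorem SchemeStep.le_increment {N : ℕ} {H : Fin N → ℝ → ℝ} {p₀ : Fin N → ℝ} {Δx Δt c : ℝ}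
    (hΔt : 0 < Δt) {U V : Fin N → ℕ → ℝ} (hS : SchemeStep H p₀ Δx Δt U V)
    (hm : ∀ α i, Hm (H α) (p₀ α) ((U α (i + 1) - U α i) / Δx) ≤ c)
    (hp : ∀ α i, Hp (H α) (p₀ α) ((U α (i + 1) - U α i) / Δx) ≤ c) (α : Fin N) (i : ℕ) :
    -Δt * c ≤ V α i - U α i := by
  obtain ⟨h1, -, h3⟩ := hS
  rcases i with _ | i
  · have : Nonempty (Fin N) := ⟨α⟩
    have := mul_le_mul_of_nonneg_left (csSup_le (range_nonempty fun β : Fin N =>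
      Hm (H β) (p₀ β) ((U β 1 - U β 0) / Δx)) (a := c)
      (by rintro _ ⟨β, rfl⟩; exact hm β 0)) hΔt.le
    rw [h3 α]
    linarith
  · have := mul_le_mul_of_nonneg_left (max_le (hp α i) (hm α (i + 1))) hΔt.le
    rw [h1 α (i + 1) (Nat.succ_pos i), Nat.add_sub_cancel]
    linarith

/-- **CFL′ implies the natural CFL condition** (Remark 2.4).
Assume (A1) and that `m⁰` is finite. If `U` solves the scheme (NS) and the CFL condition
(CFL′) holds, then for every `n_T` the natural CFL condition holds:
`Δx/Δt ≥ |H'_α(p^{α,n}_{i,+})|` for all `α`, `i ≥ 0` and `0 ≤ n ≤ n_T`. -/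
theorem CFLprime_implies_natural_CFL {N : ℕ} (hN : 1 ≤ N)
    (H : Fin N → ℝ → ℝ) (p₀ : Fin N → ℝ)
    (hA1 : ∀ α, A1cond (H α) (p₀ α))
    (Δx Δt : ℝ) (hΔx : 0 < Δx) (hΔt : 0 < Δt)
    (U : Fin N → ℕ → ℕ → ℝ)
    (hU : SchemeNS H p₀ Δx Δt U)
    (m0 : ℝ)
    (hm0 : IsGLB (Set.range fun q : Fin N × ℕ => (U q.1 1 q.2 - U q.1 0 q.2) / Δt) m0)
    (plow pbar : Fin N → ℝ)
    (hplow : ∀ α, plow α = sInf {p : ℝ | Hm (H α) (p₀ α) p = -m0})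
    (hpbar : ∀ α, pbar α = sSup {p : ℝ | Hp (H α) (p₀ α) p = -m0})
    (hCFL : ∀ α : Fin N, ∀ p ∈ Icc (plow α) (pbar α), |deriv (H α) p| ≤ Δx / Δt) :
    ∀ nT : ℕ, ∀ (α : Fin N) (n : ℕ), n ≤ nT → ∀ i : ℕ,
      |deriv (H α) ((U α n (i + 1) - U α n i) / Δx)| ≤ Δx / Δt := by
  have hinc : ∀ α i, -Δt * -m0 ≤ U α 1 i - U α 0 i := fun α i => by
    have h := hm0.1 ⟨(α, i), rfl⟩
    rw [le_div_iff₀ hΔt] at h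
    linarith
  have hbase : ∀ α i, Hm (H α) (p₀ α) ((U α 0 (i + 1) - U α 0 i) / Δx) ≤ -m0 ∧
      Hp (H α) (p₀ α) ((U α 0 (i + 1) - U α 0 i) / Δx) ≤ -m0 := fun α i => by
    obtain ⟨h1, h2⟩ := (hU 0).increment_le hΔt α i
    exact ⟨(mul_le_mul_left_of_neg (neg_lt_zero.2 hΔt)).1 ((hinc α i).trans h1),
      (mul_le_mul_left_of_neg (neg_lt_zero.2 hΔt)).1 ((hinc α (i + 1)).trans h2)⟩
  have hc : ∀ α, H α (p₀ α) ≤ -m0 := fun α => ((hA1 α).le_Hp _).trans (hbase α 0).2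
  have hlo : ∀ α, plow α ≤ p₀ α ∧ Hm (H α) (p₀ α) (plow α) = -m0 ∧
      ∀ p, Hm (H α) (p₀ α) p ≤ -m0 ↔ plow α ≤ p := fun α => by
    rw [hplow α]
    exact (hA1 α).sInf_level (hc α)
  have hhi : ∀ α, p₀ α ≤ pbar α ∧ Hp (H α) (p₀ α) (pbar α) = -m0 ∧
      ∀ p, Hp (H α) (p₀ α) p ≤ -m0 ↔ p ≤ pbar α := fun α => by
    rw [hpbar α]
    exact (hA1 α).sSup_level (hc α)
  have hmain : ∀ n α i, (U α n (i + 1) - U α n i) / Δx ∈ Icc (plow α) (pbar α) := by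
    intro n
    induction n with
    | zero =>
      exact fun α i => ⟨((hlo α).2.2 _).1 (hbase α i).1, ((hhi α).2.2 _).1 (hbase α i).2⟩
    | succ n ih =>
      intro α i
      have hW := (hU n).le_increment hΔt (c := -m0) (fun β j => ((hlo β).2.2 _).2 (ih β j).1)
        (fun β j => ((hhi β).2.2 _).2 (ih β j).2) α
      obtain ⟨h1, h2⟩ := (hU n).increment_le hΔt α i
      obtain ⟨hl, hleq, -⟩ := hlo α
      obtain ⟨hh, hheq, -⟩ := hhi α
      have e1 := (hA1 α).sub_Hm_le hl
        (fun x hx => hCFL α x ⟨hx.1, hx.2.trans hh⟩) (ih α i).1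
      have e2 := (hA1 α).sub_Hp_le hh
        (fun x hx => hCFL α x ⟨hl.trans hx.1, hx.2⟩) (ih α i).2
      have w0 := hW i
      have w1 := hW (i + 1)
      rw [hleq] at e1
      rw [hheq] at e2
      have s1 := mul_le_mul_of_nonneg_left e1 hΔt.le
      have s2 := mul_le_mul_of_nonneg_left e2 hΔt.le
      have r1 : Δt * (Δx / Δt * ((U α n (i + 1) - U α n i) / Δx - plow α)) =
          U α n (i + 1) - U α n i - plow α * Δx := by field_simp
      have r2 : Δt * (Δx / Δt * (pbar α - (U α n (i + 1) - U α n i) / Δx)) =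
          pbar α * Δx - (U α n (i + 1) - U α n i) := by field_simp
      rw [r1] at s1
      rw [r2] at s2
      rw [mem_Icc, le_div_iff₀ hΔx, div_le_iff₀ hΔx]
      constructor <;> linarith
  exact fun _ α n _ i => hCFL α _ (hmain n α i)
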